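/- arXiv:2105.13511 — 5 statements merged into one kernel-verified Lean document; each statement's English description precedes it below -/
import Mathlib

section
/- Let ε ≥ 0 and a ∈ ℝ^d, set δ := ‖a − a⋆‖, and let a′ ∈ ℝ^d be any point with ‖a′ − (a − (H_F(a))⁻¹ g_F(a))‖ ≤ ε, with δ′ := ‖a′ − a⋆‖. Then δ′ ≤ (M/(2μ)) δ² + ε. -/
open scoped RealInnerProductSpace

/-- First-order Taylor bound for a map whose derivative is `M`-Lipschitz at the base point. -/
theorem norm_sub_sub_fderiv_le_of_lipschitz {E G : Type*} [NormedAddCommGroup E] [NormedSpace ℝ E]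
    [NormedAddCommGroup G] [NormedSpace ℝ G] {g : E → G} {g' : E → E →L[ℝ] G} {M : ℝ}
    (hg : ∀ x, HasFDerivAt g (g' x) x) (a b : E) (hLip : ∀ x, ‖g' x - g' a‖ ≤ M * ‖x - a‖) :
    ‖g b - g a - g' a (b - a)‖ ≤ M / 2 * ‖b - a‖ ^ 2 := by
  set w := b - a with hw
  have hline (t : ℝ) : HasDerivAt (fun t : ℝ => a + t • w) w t := by
    simpa using ((hasDerivAt_id t).smul_const w).const_add a
  have hderiv (t : ℝ) : HasDerivAt (fun t : ℝ => g (a + t • w) - g a - t • g' a w)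
      (g' (a + t • w) w - g' a w) t := by
    have h₁ := ((hg (a + t • w)).comp_hasDerivAt t (hline t)).sub_const (g a)
    have h₂ : HasDerivAt (fun t : ℝ => t • g' a w) (g' a w) t := by
      simpa using (hasDerivAt_id t).smul_const (g' a w)
    exact h₁.sub h₂
  have hB (t : ℝ) : HasDerivAt (fun t : ℝ => M / 2 * ‖w‖ ^ 2 * t ^ 2) (M * ‖w‖ ^ 2 * t) t := by
    refine ((hasDerivAt_pow 2 t).const_mul (M / 2 * ‖w‖ ^ 2)).congr_deriv ?_
    norm_num
    ring
  have key := image_norm_le_of_norm_deriv_right_le_deriv_boundary (a := 0) (b := 1)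
    (fun t _ => (hderiv t).continuousAt.continuousWithinAt)
    (fun t _ => (hderiv t).hasDerivWithinAt) (by simp) hB
    (fun t ht => by
      calc ‖g' (a + t • w) w - g' a w‖ = ‖(g' (a + t • w) - g' a) w‖ := by simp
        _ ≤ ‖g' (a + t • w) - g' a‖ * ‖w‖ := ContinuousLinearMap.le_opNorm _ _
        _ ≤ M * ‖a + t • w - a‖ * ‖w‖ := by gcongr; exact hLip _
        _ = M * ‖w‖ ^ 2 * t := by
          rw [add_sub_cancel_left, norm_smul, Real.norm_of_nonneg ht.1]
          ring)
    (Set.right_mem_Icc.2 zero_le_one)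
  simpa [hw] using key

/-- The derivative of a `μ`-strongly monotone vector field is bounded below by `μ`. -/
theorem mul_norm_le_norm_of_strongly_monotone {E : Type*} [NormedAddCommGroup E]
    [InnerProductSpace ℝ E] {g : E → E} {g' : E →L[ℝ] E} {μ : ℝ} {x : E}
    (hg : HasFDerivAt g g' x) (hmono : ∀ a b, μ * ‖a - b‖ ^ 2 ≤ ⟪g a - g b, a - b⟫) (v : E) :
    μ * ‖v‖ ≤ ‖g' v‖ := by
  have hcoercive : μ * ‖v‖ ^ 2 ≤ ⟪g' v, v⟫ := by
    have hline : HasDerivAt (fun t : ℝ => x + t • v) v 0 := by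
      simpa using ((hasDerivAt_id (0 : ℝ)).smul_const v).const_add x
    have hcomp : HasDerivAt (fun t : ℝ => g (x + t • v)) (g' v) 0 := by
      refine HasFDerivAt.comp_hasDerivAt (0 : ℝ) ?_ hline
      simpa using hg
    have hderiv : HasDerivAt (fun t : ℝ => ⟪g (x + t • v), v⟫ - t * (μ * ‖v‖ ^ 2))
        (⟪g' v, v⟫ - μ * ‖v‖ ^ 2) 0 := by
      have h₁ := hcomp.inner ℝ (hasDerivAt_const (0 : ℝ) v)
      have h₂ := (hasDerivAt_id (0 : ℝ)).mul_const (μ * ‖v‖ ^ 2)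
      exact (h₁.sub h₂).congr_deriv (by simp)
    have hmono' : Monotone (fun t : ℝ => ⟪g (x + t • v), v⟫ - t * (μ * ‖v‖ ^ 2)) := by
      intro s t hst
      rcases hst.eq_or_lt with rfl | hlt
      · exact le_rfl
      have h := hmono (x + t • v) (x + s • v)
      rw [add_sub_add_left_eq_sub, ← sub_smul, norm_smul, inner_smul_right,
        Real.norm_of_nonneg (sub_nonneg.2 hst), inner_sub_left] at h
      have h' : (t - s) * ((t - s) * (μ * ‖v‖ ^ 2)) ≤
          (t - s) * (⟪g (x + t • v), v⟫ - ⟪g (x + s • v), v⟫) := by linarith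
      have := le_of_mul_le_mul_left h' (sub_pos.2 hlt)
      dsimp only
      linarith
    have := hmono'.deriv_nonneg (x := 0)
    rw [hderiv.deriv] at this
    linarith
  rcases eq_or_ne v 0 with rfl | hv
  · simp
  · have := hcoercive.trans (real_inner_le_norm (g' v) v)
    exact le_of_mul_le_mul_right (by linarith) (norm_pos_iff.2 hv)

/-- One approximate Newton step: if
`‖a′ − (a − (H_F(a))⁻¹ g_F(a))‖ ≤ ε` with `ε ≥ 0`, then
`δ′ ≤ (M/(2μ)) δ² + ε` where `δ = ‖a − a⋆‖`, `δ′ = ‖a′ − a⋆‖`. -/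
theorem stmt7 (d : ℕ) (hd : 1 ≤ d)
    (F : EuclideanSpace ℝ (Fin d) → ℝ) (hF : ContDiff ℝ 2 F)
    (μ M : ℝ) (hμ : 0 < μ) (hM : 0 < M)
    (hconv : ∀ a b : EuclideanSpace ℝ (Fin d),
      F a ≥ F b + ⟪gradient F b, a - b⟫ + μ / 2 * ‖a - b‖ ^ 2)
    (H : EuclideanSpace ℝ (Fin d) →
      (EuclideanSpace ℝ (Fin d) →L[ℝ] EuclideanSpace ℝ (Fin d)))
    (hH : ∀ x, HasFDerivAt (gradient F) (H x) x)
    (hLip : ∀ a b : EuclideanSpace ℝ (Fin d), ‖H a - H b‖ ≤ M * ‖a - b‖)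
    (astar : EuclideanSpace ℝ (Fin d)) (hmin : ∀ x, F astar ≤ F x)
    (hmin_unique : ∀ b, (∀ x, F b ≤ F x) → b = astar)
    (ε : ℝ) (hε : 0 ≤ ε) (a a' : EuclideanSpace ℝ (Fin d))
    (hstep : ‖a' - (a - (H a).inverse (gradient F a))‖ ≤ ε) :
    ‖a' - astar‖ ≤ M / (2 * μ) * ‖a - astar‖ ^ 2 + ε := by
  have hmono (x y : EuclideanSpace ℝ (Fin d)) :
      μ * ‖x - y‖ ^ 2 ≤ ⟪gradient F x - gradient F y, x - y⟫ := by
    have h₁ := hconv x y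
    have h₂ := hconv y x
    rw [← neg_sub x y, inner_neg_right, norm_neg] at h₂
    rw [inner_sub_left]
    linarith
  have hbound := mul_norm_le_norm_of_strongly_monotone (hH a) hmono
  have hinj : Function.Injective (H a) := by
    refine (injective_iff_map_eq_zero (H a)).2 fun v hv => norm_le_zero_iff.1 ?_
    have := hbound v
    rw [hv, norm_zero] at this
    exact nonpos_of_mul_nonpos_right this hμ
  let e := (LinearEquiv.ofInjectiveEndo (H a).toLinearMap hinj).toContinuousLinearEquiv
  have he : (e : EuclideanSpace ℝ (Fin d) →L[ℝ] EuclideanSpace ℝ (Fin d)) = H a := by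
    ext1 v
    rfl
  have hinv (y) : H a ((H a).inverse y) = y := by
    rw [← he, ContinuousLinearMap.inverse_equiv]
    exact e.apply_symm_apply y
  have hgrad : gradient F astar = 0 := by
    have : IsLocalMin F astar := Filter.Eventually.of_forall hmin
    rw [gradient, this.fderiv_eq_zero, map_zero]
  have htaylor := norm_sub_sub_fderiv_le_of_lipschitz hH a astar fun x => hLip x a
  set u := a - (H a).inverse (gradient F a) - astar with hu
  have hHu : H a u = gradient F astar - gradient F a - H a (astar - a) := by
    rw [hu, hgrad, map_sub, map_sub, hinv, map_sub]
    abel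
  rw [← hHu, norm_sub_rev] at htaylor
  have hnewton : ‖u‖ ≤ M / (2 * μ) * ‖a - astar‖ ^ 2 := by
    refine le_of_mul_le_mul_left ((hbound u).trans (htaylor.trans_eq ?_)) hμ
    field_simp
  calc ‖a' - astar‖ = ‖u + (a' - (a - (H a).inverse (gradient F a)))‖ := by
        rw [hu]
        congr 1
        abel
    _ ≤ _ := norm_add_le_of_le hnewton hstep
end

section
/- Let ε ≥ 0 satisfy 2Mε/μ < 1 and define δ_± := (μ/M)(1 ± √(1 − 2Mε/μ)). Let a ∈ ℝ^d, set δ := ‖a − a⋆‖, and let a′ ∈ ℝ^d be any point with ‖a′ − (a − (H_F(a))⁻¹ g_F(a))‖ ≤ ε, with δ′ := ‖a′ − a⋆‖. Then: (i) if δ_− < δ < δ_+ then δ′ < δ; (ii) if δ ≤ δ_− then δ′ ≤ δ_−. -/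
open scoped RealInnerProductSpace

/-- The gradient of a strongly convex function expands distances by the convexity modulus. -/
theorem mul_norm_sub_le_norm_gradient_sub {E : Type*} [NormedAddCommGroup E]
    [InnerProductSpace ℝ E] [CompleteSpace E] {F : E → ℝ} {μ : ℝ}
    (hconv : ∀ a b : E, F a ≥ F b + ⟪gradient F b, a - b⟫ + μ / 2 * ‖a - b‖ ^ 2) (a b : E) :
    μ * ‖a - b‖ ≤ ‖gradient F a - gradient F b‖ := by
  have hab := hconv a b
  have hba := hconv b a
  rw [norm_sub_rev b a, ← neg_sub a b, inner_neg_right] at hba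
  have hcs := real_inner_le_norm (gradient F a - gradient F b) (a - b)
  rw [inner_sub_left] at hcs
  rcases eq_or_lt_of_le (norm_nonneg (a - b)) with h | h
  · rw [← h, mul_zero]
    exact norm_nonneg _
  · refine le_of_mul_le_mul_right ?_ h
    nlinarith

/-- If `g` expands distances by at least `c`, so does its derivative at any point. -/
theorem HasFDerivAt.mul_norm_le_norm_apply {E G : Type*} [NormedAddCommGroup E] [NormedSpace ℝ E]
    [NormedAddCommGroup G] [NormedSpace ℝ G] {g : E → G} {c : ℝ} {x : E} {g' : E →L[ℝ] G}
    (hg : HasFDerivAt g g' x) (hc : ∀ a b, c * ‖a - b‖ ≤ ‖g a - g b‖) (v : E) :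
    c * ‖v‖ ≤ ‖g' v‖ := by
  have hlim := (hg.hasLineDerivAt v).tendsto_slope_zero_right.norm
  refine ge_of_tendsto hlim (eventually_nhdsWithin_of_forall fun t ht ↦ ?_)
  have ht : (0 : ℝ) < t := ht
  have h := hc (x + t • v) x
  rw [add_sub_cancel_left, norm_smul, Real.norm_of_nonneg ht.le] at h
  rw [norm_smul, norm_inv, Real.norm_of_nonneg ht.le]
  rw [inv_mul_eq_div, le_div_iff₀ ht]
  linarith

/-- Second-order Taylor estimate for a map with Lipschitz derivative. -/
theorem norm_sub_sub_apply_le_of_lipschitz_fderiv {E G : Type*} [NormedAddCommGroup E]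
    [NormedSpace ℝ E] [NormedAddCommGroup G] [NormedSpace ℝ G] {g : E → G} {H : E → E →L[ℝ] G}
    {M : ℝ} (hH : ∀ x, HasFDerivAt g (H x) x) (hLip : ∀ a b, ‖H a - H b‖ ≤ M * ‖a - b‖)
    (a b : E) : ‖g b - g a - H a (b - a)‖ ≤ M / 2 * ‖b - a‖ ^ 2 := by
  set v := b - a with hv
  have hderiv (t : ℝ) : HasDerivAt (fun t : ℝ ↦ g (a + t • v) - g a - t • H a v)
      (H (a + t • v) v - H a v) t := by
    have hline : HasDerivAt (fun t : ℝ ↦ a + t • v) v t := by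
      simpa using ((hasDerivAt_id t).smul_const v).const_add a
    have hlin : HasDerivAt (fun t : ℝ ↦ t • H a v) (H a v) t := by
      simpa using (hasDerivAt_id t).smul_const (H a v)
    exact (((hH _).comp_hasDerivAt t hline).sub_const _).sub hlin
  have hbound (t : ℝ) : HasDerivAt (fun t : ℝ ↦ M / 2 * ‖v‖ ^ 2 * t ^ 2)
      (M * ‖v‖ ^ 2 * t) t := by
    refine ((hasDerivAt_pow 2 t).const_mul (M / 2 * ‖v‖ ^ 2)).congr_deriv ?_
    push_cast
    ring
  have h := image_norm_le_of_norm_deriv_right_le_deriv_boundary (a := 0) (b := 1)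
    (fun t _ ↦ (hderiv t).continuousAt.continuousWithinAt)
    (fun t _ ↦ (hderiv t).hasDerivWithinAt) (by simp) hbound
    (fun t ht ↦ by
      calc ‖H (a + t • v) v - H a v‖ = ‖(H (a + t • v) - H a) v‖ := rfl
        _ ≤ ‖H (a + t • v) - H a‖ * ‖v‖ := ContinuousLinearMap.le_opNorm _ _
        _ ≤ M * ‖a + t • v - a‖ * ‖v‖ := by gcongr; exact hLip _ _
        _ = M * ‖v‖ ^ 2 * t := by
          rw [add_sub_cancel_left, norm_smul, Real.norm_of_nonneg ht.1]
          ring)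
    (Set.right_mem_Icc.2 zero_le_one)
  simpa [hv] using h

/-- Quadratic convergence of an exact Newton step towards a zero `z` of `g`. -/
theorem norm_newton_step_sub_le {E : Type*} [NormedAddCommGroup E] [NormedSpace ℝ E]
    [FiniteDimensional ℝ E] {g : E → E} {H : E → E →L[ℝ] E} {M c : ℝ} (hc : 0 < c)
    (hH : ∀ x, HasFDerivAt g (H x) x) (hLip : ∀ a b, ‖H a - H b‖ ≤ M * ‖a - b‖)
    (hg : ∀ a b, c * ‖a - b‖ ≤ ‖g a - g b‖) {z : E} (hz : g z = 0) (a : E) :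
    ‖a - (H a).inverse (g a) - z‖ ≤ M / (2 * c) * ‖a - z‖ ^ 2 := by
  have hlower := (hH a).mul_norm_le_norm_apply hg
  have hinj : Function.Injective (H a).toLinearMap := by
    refine (injective_iff_map_eq_zero _).2 fun v hv ↦ norm_le_zero_iff.1 ?_
    have h := hlower v
    rw [show H a v = 0 from hv, norm_zero] at h
    exact nonpos_of_mul_nonpos_right h hc
  have hinv : (H a).IsInvertible :=
    ⟨(LinearEquiv.ofInjectiveEndo _ hinj).toContinuousLinearEquiv, by ext v; rfl⟩
  have htaylor := norm_sub_sub_apply_le_of_lipschitz_fderiv hH hLip a z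
  have h := hlower (a - (H a).inverse (g a) - z)
  have hcancel : H a ((H a).inverse (g a)) = g a := by
    obtain ⟨e, he⟩ := hinv
    rw [← he, ContinuousLinearMap.inverse_equiv]
    exact e.apply_symm_apply _
  have heq : H a (a - (H a).inverse (g a) - z) = g z - g a - H a (z - a) := by
    rw [map_sub, map_sub, map_sub, hcancel, hz]
    abel
  rw [heq] at h
  rw [norm_sub_rev z a] at htaylor
  have hdiv : M / (2 * c) * ‖a - z‖ ^ 2 = M / 2 * ‖a - z‖ ^ 2 / c := by
    field_simp
  rw [hdiv, le_div_iff₀ hc]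
  linarith

/-- With `2Mε/μ < 1` and
`δ_± := (μ/M)(1 ± √(1 − 2Mε/μ))`, an approximate Newton step
(`‖a′ − (a − (H_F(a))⁻¹ g_F(a))‖ ≤ ε`) satisfies:
(i) if `δ_− < δ < δ_+` then `δ′ < δ`; (ii) if `δ ≤ δ_−` then `δ′ ≤ δ_−`. -/
theorem stmt8 (d : ℕ) (hd : 1 ≤ d)
    (F : EuclideanSpace ℝ (Fin d) → ℝ) (hF : ContDiff ℝ 2 F)
    (μ M : ℝ) (hμ : 0 < μ) (hM : 0 < M)
    (hconv : ∀ a b : EuclideanSpace ℝ (Fin d),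
      F a ≥ F b + ⟪gradient F b, a - b⟫ + μ / 2 * ‖a - b‖ ^ 2)
    (H : EuclideanSpace ℝ (Fin d) →
      (EuclideanSpace ℝ (Fin d) →L[ℝ] EuclideanSpace ℝ (Fin d)))
    (hH : ∀ x, HasFDerivAt (gradient F) (H x) x)
    (hLip : ∀ a b : EuclideanSpace ℝ (Fin d), ‖H a - H b‖ ≤ M * ‖a - b‖)
    (astar : EuclideanSpace ℝ (Fin d)) (hmin : ∀ x, F astar ≤ F x)
    (hmin_unique : ∀ b, (∀ x, F b ≤ F x) → b = astar)
    (ε : ℝ) (hε : 0 ≤ ε) (hεcond : 2 * M * ε / μ < 1)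
    (a a' : EuclideanSpace ℝ (Fin d))
    (hstep : ‖a' - (a - (H a).inverse (gradient F a))‖ ≤ ε) :
    (μ / M * (1 - Real.sqrt (1 - 2 * M * ε / μ)) < ‖a - astar‖ ∧
        ‖a - astar‖ < μ / M * (1 + Real.sqrt (1 - 2 * M * ε / μ)) →
      ‖a' - astar‖ < ‖a - astar‖) ∧
    (‖a - astar‖ ≤ μ / M * (1 - Real.sqrt (1 - 2 * M * ε / μ)) →
      ‖a' - astar‖ ≤ μ / M * (1 - Real.sqrt (1 - 2 * M * ε / μ))) := by
  have hgrad : gradient F astar = 0 := by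
    have h : IsLocalMin F astar := Filter.Eventually.of_forall hmin
    rw [gradient, h.fderiv_eq_zero, map_zero]
  have hnewton := norm_newton_step_sub_le hμ hH hLip
    (mul_norm_sub_le_norm_gradient_sub hconv) hgrad a
  have htri := norm_add_le (a' - (a - (H a).inverse (gradient F a)))
    (a - (H a).inverse (gradient F a) - astar)
  rw [sub_add_sub_cancel] at htri
  set δ := ‖a - astar‖
  set s := Real.sqrt (1 - 2 * M * ε / μ)
  have hs0 : 0 ≤ s := Real.sqrt_nonneg _
  have hs : s ^ 2 = 1 - 2 * M * ε / μ := Real.sq_sqrt (by linarith)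
  have hδ0 : 0 ≤ δ := norm_nonneg _
  set c := μ / M with hcdef
  have hc : 0 < c := div_pos hμ hM
  have hε_eq : ε = c * (1 - s ^ 2) / 2 := by
    rw [hs, hcdef]
    field_simp
    ring
  have hcoeff : M / (2 * μ) * δ ^ 2 = δ ^ 2 / (2 * c) := by
    rw [hcdef]
    field_simp
  have hstep_bound : ‖a' - astar‖ ≤ c * (1 - s ^ 2) / 2 + δ ^ 2 / (2 * c) := by
    linarith
  constructor
  · rintro ⟨hlow, hupp⟩
    refine hstep_bound.trans_lt ?_
    have h : δ ^ 2 / (2 * c) < δ - c * (1 - s ^ 2) / 2 := by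
      rw [div_lt_iff₀ (by positivity)]
      nlinarith [mul_pos (sub_pos.2 hlow) (sub_pos.2 hupp)]
    linarith
  · intro hle
    refine hstep_bound.trans ?_
    have h : δ ^ 2 / (2 * c) ≤ c * (1 - s) - c * (1 - s ^ 2) / 2 := by
      rw [div_le_iff₀ (by positivity)]
      nlinarith [pow_le_pow_left₀ hδ0 hle 2]
    linarith
end

section
/- Let ε > 0 satisfy 2Mε/μ < 1. If a ∈ ℝ^d satisfies ‖a − a⋆‖ ≤ 2ε and a′ ∈ ℝ^d satisfies ‖a′ − (a − (H_F(a))⁻¹ g_F(a))‖ ≤ ε, then ‖a′ − a⋆‖ ≤ 2ε. -/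
open scoped RealInnerProductSpace

/-- A strongly monotone map has a coercive derivative. -/
theorem HasFDerivAt.mul_norm_sq_le_inner {E : Type*} [NormedAddCommGroup E]
    [InnerProductSpace ℝ E] {g : E → E} {A : E →L[ℝ] E} {x : E} {μ : ℝ}
    (hA : HasFDerivAt g A x)
    (hg : ∀ a b, μ * ‖a - b‖ ^ 2 ≤ ⟪g a - g b, a - b⟫) (v : E) :
    μ * ‖v‖ ^ 2 ≤ ⟪A v, v⟫ := by
  have hline : HasDerivAt (fun t : ℝ => g (x + t • v)) (A v) 0 := by
    have h : HasDerivAt (fun t : ℝ => x + t • v) v 0 := by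
      simpa using ((hasDerivAt_id (0 : ℝ)).smul_const v).const_add x
    refine HasFDerivAt.comp_hasDerivAt (0 : ℝ) ?_ h
    simpa using hA
  have hderiv : HasDerivAt (fun t : ℝ => ⟪g (x + t • v), v⟫ - t * (μ * ‖v‖ ^ 2))
      (⟪A v, v⟫ - μ * ‖v‖ ^ 2) 0 := by
    refine ((hline.inner ℝ (hasDerivAt_const (0 : ℝ) v)).sub
      ((hasDerivAt_id (0 : ℝ)).mul_const (μ * ‖v‖ ^ 2))).congr_deriv ?_
    simp
  have hmono : Monotone (fun t : ℝ => ⟪g (x + t • v), v⟫ - t * (μ * ‖v‖ ^ 2)) := by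
    refine monotone_iff_forall_lt.2 fun s t hst => ?_
    have h := hg (x + t • v) (x + s • v)
    rw [add_sub_add_left_eq_sub, ← sub_smul, norm_smul, inner_smul_right, inner_sub_left,
      mul_pow, Real.norm_eq_abs, sq_abs] at h
    have h' : (t - s) * ((t - s) * (μ * ‖v‖ ^ 2)) ≤
        (t - s) * (⟪g (x + t • v), v⟫ - ⟪g (x + s • v), v⟫) := by
      linarith
    linarith [le_of_mul_le_mul_left h' (sub_pos.2 hst)]
  exact sub_nonneg.1 (hderiv.nonneg_of_monotone hmono)

/-- The first-order Taylor remainder of a map with `M`-Lipschitz derivative is at most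
`M / 2` times the squared distance. -/
theorem norm_taylor_remainder_le_of_lipschitz_fderiv {E G : Type*} [NormedAddCommGroup E]
    [NormedSpace ℝ E] [NormedAddCommGroup G] [NormedSpace ℝ G] {g : E → G}
    {g' : E → E →L[ℝ] G} {M : ℝ} (hg : ∀ x, HasFDerivAt g (g' x) x)
    (hLip : ∀ a b, ‖g' a - g' b‖ ≤ M * ‖a - b‖) (a b : E) :
    ‖g b - g a - g' a (b - a)‖ ≤ M / 2 * ‖b - a‖ ^ 2 := by
  set v := b - a with hv
  have hderiv (t : ℝ) : HasDerivAt (fun t : ℝ => g (a + t • v) - g a - t • g' a v)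
      (g' (a + t • v) v - g' a v) t := by
    have h : HasDerivAt (fun t : ℝ => a + t • v) v t := by
      simpa using ((hasDerivAt_id t).smul_const v).const_add a
    refine ((((hg (a + t • v)).comp_hasDerivAt t h).sub_const (g a)).sub
      ((hasDerivAt_id t).smul_const (g' a v))).congr_deriv ?_
    simp
  have hB (t : ℝ) : HasDerivAt (fun t : ℝ => M / 2 * ‖v‖ ^ 2 * t ^ 2) (M * ‖v‖ ^ 2 * t) t := by
    refine ((hasDerivAt_pow 2 t).const_mul (M / 2 * ‖v‖ ^ 2)).congr_deriv ?_
    norm_num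
    ring
  have h := image_norm_le_of_norm_deriv_right_le_deriv_boundary (a := 0) (b := 1)
    (fun t _ => (hderiv t).continuousAt.continuousWithinAt)
    (fun t _ => (hderiv t).hasDerivWithinAt) (by simp) hB
    (fun t ht => by
      calc ‖g' (a + t • v) v - g' a v‖ = ‖(g' (a + t • v) - g' a) v‖ := rfl
        _ ≤ M * ‖a + t • v - a‖ * ‖v‖ :=
          (g' (a + t • v) - g' a).le_of_opNorm_le (hLip _ _) v
        _ = M * ‖v‖ ^ 2 * t := by
          rw [add_sub_cancel_left, norm_smul, Real.norm_of_nonneg ht.1]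
          ring)
    (Set.right_mem_Icc.2 zero_le_one)
  simpa [hv] using h

/-- A coercive endomorphism is bounded below. -/
theorem ContinuousLinearMap.mul_norm_le_norm_apply_of_coercive {E : Type*}
    [NormedAddCommGroup E] [InnerProductSpace ℝ E] {A : E →L[ℝ] E} {μ : ℝ}
    (hA : ∀ v, μ * ‖v‖ ^ 2 ≤ ⟪A v, v⟫) (v : E) : μ * ‖v‖ ≤ ‖A v‖ := by
  rcases eq_or_ne v 0 with rfl | hv
  · simp
  · have h := (hA v).trans (real_inner_le_norm (A v) v)
    exact le_of_mul_le_mul_right (by linarith) (norm_pos_iff.2 hv)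

theorem ContinuousLinearMap.isInvertible_of_injective {E : Type*} [NormedAddCommGroup E]
    [NormedSpace ℝ E] [FiniteDimensional ℝ E] {A : E →L[ℝ] E} (hA : Function.Injective A) :
    A.IsInvertible :=
  ⟨(LinearEquiv.ofInjectiveEndo (A : E →ₗ[ℝ] E) hA).toContinuousLinearEquiv, by ext; simp⟩

theorem gradient_eq_zero_of_forall_le {E : Type*} [NormedAddCommGroup E]
    [InnerProductSpace ℝ E] [CompleteSpace E] {F : E → ℝ} {x : E} (h : ∀ y, F x ≤ F y) :
    gradient F x = 0 := by
  have hx : IsLocalMin F x := Filter.Eventually.of_forall h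
  simp [gradient, hx.fderiv_eq_zero]

/-- If `2Mε/μ < 1`, `‖a − a⋆‖ ≤ 2ε`, and `a′` is an
`ε`-approximate Newton update of `a`, then `‖a′ − a⋆‖ ≤ 2ε`. -/
theorem stmt12 (d : ℕ) (hd : 1 ≤ d)
    (F : EuclideanSpace ℝ (Fin d) → ℝ) (hF : ContDiff ℝ 2 F)
    (μ M : ℝ) (hμ : 0 < μ) (hM : 0 < M)
    (hconv : ∀ a b : EuclideanSpace ℝ (Fin d),
      F a ≥ F b + ⟪gradient F b, a - b⟫ + μ / 2 * ‖a - b‖ ^ 2)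
    (H : EuclideanSpace ℝ (Fin d) →
      (EuclideanSpace ℝ (Fin d) →L[ℝ] EuclideanSpace ℝ (Fin d)))
    (hH : ∀ x, HasFDerivAt (gradient F) (H x) x)
    (hLip : ∀ a b : EuclideanSpace ℝ (Fin d), ‖H a - H b‖ ≤ M * ‖a - b‖)
    (astar : EuclideanSpace ℝ (Fin d)) (hmin : ∀ x, F astar ≤ F x)
    (hmin_unique : ∀ b, (∀ x, F b ≤ F x) → b = astar)
    (ε : ℝ) (hε : 0 < ε) (hεcond : 2 * M * ε / μ < 1)
    (a a' : EuclideanSpace ℝ (Fin d))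
    (ha : ‖a - astar‖ ≤ 2 * ε)
    (hstep : ‖a' - (a - (H a).inverse (gradient F a))‖ ≤ ε) :
    ‖a' - astar‖ ≤ 2 * ε := by
  have hmonotone (x y : EuclideanSpace ℝ (Fin d)) :
      μ * ‖x - y‖ ^ 2 ≤ ⟪gradient F x - gradient F y, x - y⟫ := by
    have hxy := hconv x y
    have hyx := hconv y x
    rw [← neg_sub x y, inner_neg_right, norm_neg] at hyx
    rw [inner_sub_left]
    linarith
  have hlower := ContinuousLinearMap.mul_norm_le_norm_apply_of_coercive
    ((hH a).mul_norm_sq_le_inner hmonotone)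
  have hinv : (H a).IsInvertible := by
    refine ContinuousLinearMap.isInvertible_of_injective
      ((injective_iff_map_eq_zero (H a)).2 fun v hv => norm_le_zero_iff.1 ?_)
    have h := hlower v
    rw [hv, norm_zero] at h
    exact nonpos_of_mul_nonpos_right h hμ
  have htaylor := norm_taylor_remainder_le_of_lipschitz_fderiv hH hLip a astar
  set n := a - (H a).inverse (gradient F a) with hn
  have hresidual : H a (n - astar) = gradient F astar - gradient F a - H a (astar - a) := by
    rw [gradient_eq_zero_of_forall_le hmin, hn]
    simp only [map_sub, hinv.self_apply_inverse]
    abel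
  have hnewton : ‖n - astar‖ ≤ ε := by
    rw [← hresidual, norm_sub_rev astar a] at htaylor
    have hsq : ‖a - astar‖ ^ 2 ≤ (2 * ε) ^ 2 := by gcongr
    have hμε : 2 * M * ε < μ := by rwa [div_lt_one hμ] at hεcond
    refine le_of_mul_le_mul_left ?_ hμ
    calc μ * ‖n - astar‖ ≤ M / 2 * ‖a - astar‖ ^ 2 := (hlower _).trans htaylor
      _ ≤ M / 2 * (2 * ε) ^ 2 := by gcongr
      _ = 2 * M * ε * ε := by ring
      _ ≤ μ * ε := by gcongr
  linarith [norm_sub_le_norm_sub_add_norm_sub a' n astar]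
end

section
/- Let ε > 0. If a ∈ ℝ^d satisfies ‖a − a⋆‖ ≤ √(2με/M) and a′ ∈ ℝ^d satisfies ‖a′ − (a − (H_F(a))⁻¹ g_F(a))‖ ≤ ε, then ‖a′ − a⋆‖ ≤ 2ε. -/
open scoped RealInnerProductSpace

section NewtonStep

variable {E : Type*} [NormedAddCommGroup E] [InnerProductSpace ℝ E]

/-- The second-order Taylor bound for a map whose derivative is `M`-Lipschitz. -/
theorem norm_sub_sub_le_of_hasFDerivAt_of_lipschitz {g : E → E} {H : E → E →L[ℝ] E} {M : ℝ}
    (hH : ∀ x, HasFDerivAt g (H x) x) (hLip : ∀ a b, ‖H a - H b‖ ≤ M * ‖a - b‖) (a v : E) :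
    ‖g (a + v) - g a - H a v‖ ≤ M / 2 * ‖v‖ ^ 2 := by
  have hline (t : ℝ) : HasDerivAt (fun t : ℝ => a + t • v) v t := by
    simpa using ((hasDerivAt_id t).smul_const v).const_add a
  have hf (t : ℝ) : HasDerivAt (fun t : ℝ => g (a + t • v) - g a - t • H a v)
      (H (a + t • v) v - H a v) t := by
    have h := (((hH (a + t • v)).comp_hasDerivAt t (hline t)).sub_const (g a)).fun_sub
      ((hasDerivAt_id t).smul_const (H a v))
    simpa using h
  have hB (t : ℝ) : HasDerivAt (fun t : ℝ => M / 2 * ‖v‖ ^ 2 * t ^ 2) (M * ‖v‖ ^ 2 * t) t := by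
    refine ((hasDerivAt_pow 2 t).const_mul (M / 2 * ‖v‖ ^ 2)).congr_deriv ?_
    push_cast
    ring
  have h := image_norm_le_of_norm_deriv_right_le_deriv_boundary (a := (0 : ℝ)) (b := 1)
    (fun t _ => (hf t).continuousAt.continuousWithinAt) (fun t _ => (hf t).hasDerivWithinAt)
    (by simp) hB (fun t ht => by
      calc ‖H (a + t • v) v - H a v‖ = ‖(H (a + t • v) - H a) v‖ := rfl
        _ ≤ ‖H (a + t • v) - H a‖ * ‖v‖ := ContinuousLinearMap.le_opNorm _ _
        _ ≤ M * ‖a + t • v - a‖ * ‖v‖ := by gcongr; exact hLip _ _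
        _ = M * ‖v‖ ^ 2 * t := by
          rw [add_sub_cancel_left, norm_smul, Real.norm_of_nonneg ht.1]
          ring)
    (Set.right_mem_Icc.2 zero_le_one)
  simpa using h

/-- The derivative of a strongly monotone map is coercive. -/
theorem mul_norm_sq_le_inner_of_hasFDerivAt_of_strongly_monotone {g : E → E} {a : E}
    {H : E →L[ℝ] E} {μ : ℝ} (hH : HasFDerivAt g H a)
    (hmono : ∀ x y, μ * ‖x - y‖ ^ 2 ≤ ⟪g x - g y, x - y⟫) (v : E) :
    μ * ‖v‖ ^ 2 ≤ ⟪H v, v⟫ := by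
  have hline : HasDerivAt (fun t : ℝ => a + t • v) v 0 := by
    simpa using ((hasDerivAt_id (0 : ℝ)).smul_const v).const_add a
  have hd : HasDerivAt (fun t : ℝ => ⟪g (a + t • v), v⟫ - t * (μ * ‖v‖ ^ 2))
      (⟪H v, v⟫ - μ * ‖v‖ ^ 2) 0 := by
    have hg : HasDerivAt (fun t : ℝ => g (a + t • v)) (H v) 0 :=
      HasFDerivAt.comp_hasDerivAt (0 : ℝ) (by simpa using hH) hline
    have h := (hg.inner ℝ (hasDerivAt_const (0 : ℝ) v)).fun_sub
      ((hasDerivAt_id (0 : ℝ)).mul_const (μ * ‖v‖ ^ 2))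
    simpa using h
  have hm : Monotone fun t : ℝ => ⟪g (a + t • v), v⟫ - t * (μ * ‖v‖ ^ 2) := by
    intro s t hst
    rcases hst.eq_or_lt with rfl | hst
    · exact le_rfl
    have h := hmono (a + t • v) (a + s • v)
    rw [add_sub_add_left_eq_sub, ← sub_smul, norm_smul, real_inner_smul_right,
      Real.norm_of_nonneg (sub_nonneg.2 hst.le), inner_sub_left] at h
    have hpos := sub_pos.2 hst
    have h' : (t - s) * ((t - s) * (μ * ‖v‖ ^ 2)) ≤
        (t - s) * (⟪g (a + t • v), v⟫ - ⟪g (a + s • v), v⟫) := by linarith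
    have := le_of_mul_le_mul_left h' hpos
    dsimp only
    linarith
  have := hm.deriv_nonneg (x := 0)
  rw [hd.deriv] at this
  linarith

/-- A coercive operator on a finite-dimensional space is invertible. -/
theorem ContinuousLinearMap.isInvertible_of_mul_norm_sq_le_inner [FiniteDimensional ℝ E]
    {H : E →L[ℝ] E} {μ : ℝ} (hμ : 0 < μ) (hH : ∀ v, μ * ‖v‖ ^ 2 ≤ ⟪H v, v⟫) :
    H.IsInvertible := by
  have hinj : Function.Injective (H : E →ₗ[ℝ] E) := by
    refine (injective_iff_map_eq_zero _).2 fun v hv => ?_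
    have h := hH v
    rw [show H v = 0 from hv, inner_zero_left] at h
    by_contra hne
    have : 0 < ‖v‖ := norm_pos_iff.2 hne
    have : 0 < μ * ‖v‖ ^ 2 := by positivity
    linarith
  exact ⟨(LinearEquiv.ofInjectiveEndo _ hinj).toContinuousLinearEquiv, by ext; rfl⟩

/-- The norm lower bound given by coercivity. -/
theorem mul_norm_le_norm_of_mul_norm_sq_le_inner {v w : E} {μ : ℝ}
    (h : μ * ‖v‖ ^ 2 ≤ ⟪w, v⟫) : μ * ‖v‖ ≤ ‖w‖ := by
  rcases (norm_nonneg v).eq_or_lt with hv | hv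
  · simp [← hv]
  · refine le_of_mul_le_mul_right ?_ hv
    linarith [real_inner_le_norm w v]

/-- Quadratic convergence of one exact Newton step for a strongly monotone map. -/
theorem mul_norm_newton_step_sub_le [FiniteDimensional ℝ E] {g : E → E} {H : E → E →L[ℝ] E}
    {μ M : ℝ} (hμ : 0 < μ) (hH : ∀ x, HasFDerivAt g (H x) x)
    (hLip : ∀ a b, ‖H a - H b‖ ≤ M * ‖a - b‖)
    (hmono : ∀ x y, μ * ‖x - y‖ ^ 2 ≤ ⟪g x - g y, x - y⟫) (a : E) {z : E} (hz : g z = 0) :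
    μ * ‖a - (H a).inverse (g a) - z‖ ≤ M / 2 * ‖a - z‖ ^ 2 := by
  have hcoer := mul_norm_sq_le_inner_of_hasFDerivAt_of_strongly_monotone (hH a) hmono
  have hinv : H a ((H a).inverse (g a)) = g a := by
    obtain ⟨e, he⟩ := ContinuousLinearMap.isInvertible_of_mul_norm_sq_le_inner hμ hcoer
    simp [← he]
  refine (mul_norm_le_norm_of_mul_norm_sq_le_inner (hcoer _)).trans ?_
  have h := norm_sub_sub_le_of_hasFDerivAt_of_lipschitz hH hLip a (z - a)
  rw [add_sub_cancel, hz, norm_sub_rev z a] at h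
  have heq : H a (a - (H a).inverse (g a) - z) = 0 - g a - H a (z - a) := by
    simp only [map_sub, hinv]
    abel
  rwa [heq]

end NewtonStep

/-- If `‖a − a⋆‖ ≤ √(2με/M)` and `a′` is an `ε`-approximate
Newton update of `a`, then `‖a′ − a⋆‖ ≤ 2ε`. -/
theorem stmt13 (d : ℕ) (hd : 1 ≤ d)
    (F : EuclideanSpace ℝ (Fin d) → ℝ) (hF : ContDiff ℝ 2 F)
    (μ M : ℝ) (hμ : 0 < μ) (hM : 0 < M)
    (hconv : ∀ a b : EuclideanSpace ℝ (Fin d),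
      F a ≥ F b + ⟪gradient F b, a - b⟫ + μ / 2 * ‖a - b‖ ^ 2)
    (H : EuclideanSpace ℝ (Fin d) →
      (EuclideanSpace ℝ (Fin d) →L[ℝ] EuclideanSpace ℝ (Fin d)))
    (hH : ∀ x, HasFDerivAt (gradient F) (H x) x)
    (hLip : ∀ a b : EuclideanSpace ℝ (Fin d), ‖H a - H b‖ ≤ M * ‖a - b‖)
    (astar : EuclideanSpace ℝ (Fin d)) (hmin : ∀ x, F astar ≤ F x)
    (hmin_unique : ∀ b, (∀ x, F b ≤ F x) → b = astar)
    (ε : ℝ) (hε : 0 < ε)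
    (a a' : EuclideanSpace ℝ (Fin d))
    (ha : ‖a - astar‖ ≤ Real.sqrt (2 * μ * ε / M))
    (hstep : ‖a' - (a - (H a).inverse (gradient F a))‖ ≤ ε) :
    ‖a' - astar‖ ≤ 2 * ε := by
  have hmono (x y : EuclideanSpace ℝ (Fin d)) :
      μ * ‖x - y‖ ^ 2 ≤ ⟪gradient F x - gradient F y, x - y⟫ := by
    have h₁ := hconv x y
    have h₂ := hconv y x
    rw [← neg_sub x y, inner_neg_right, norm_neg] at h₂
    rw [inner_sub_left]
    linarith
  have hz : gradient F astar = 0 := by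
    have : fderiv ℝ F astar = 0 :=
      IsLocalMin.fderiv_eq_zero (Filter.Eventually.of_forall hmin)
    simp [gradient, this]
  have hsq : ‖a - astar‖ ^ 2 ≤ 2 * μ * ε / M := by
    refine (pow_le_pow_left₀ (norm_nonneg _) ha 2).trans_eq (Real.sq_sqrt (by positivity))
  have hnewton : ‖a - (H a).inverse (gradient F a) - astar‖ ≤ ε := by
    refine le_of_mul_le_mul_left ?_ hμ
    calc _ ≤ M / 2 * ‖a - astar‖ ^ 2 := mul_norm_newton_step_sub_le hμ hH hLip hmono a hz
      _ ≤ M / 2 * (2 * μ * ε / M) := by gcongr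
      _ = μ * ε := by field_simp
  calc ‖a' - astar‖ ≤ ‖a' - (a - (H a).inverse (gradient F a))‖ +
        ‖a - (H a).inverse (gradient F a) - astar‖ := norm_sub_le_norm_sub_add_norm_sub _ _ _
    _ ≤ 2 * ε := by linarith
end

section
/- If a ∈ ℝ^d satisfies δ := ‖a − a⋆‖ < 2μ/M, then the errorless Newton update difference satisfies ‖(H_F(a))⁻¹ g_F(a)‖ ≤ 2δ. -/
open scoped RealInnerProductSpace

section

variable {E : Type*} [NormedAddCommGroup E] [InnerProductSpace ℝ E]

/-- The derivative of a strongly monotone map is coercive. -/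
theorem mul_norm_sq_le_inner_of_hasFDerivAt {g : E → E} {A : E →L[ℝ] E} {a : E} {μ : ℝ}
    (hg : ∀ x y, μ * ‖x - y‖ ^ 2 ≤ ⟪g x - g y, x - y⟫) (hA : HasFDerivAt g A a) (v : E) :
    μ * ‖v‖ ^ 2 ≤ ⟪A v, v⟫ := by
  have hline : HasDerivAt (fun t : ℝ => a + t • v) v 0 := by
    simpa using ((hasDerivAt_id (0 : ℝ)).smul_const v).const_add a
  have hcomp : HasDerivAt (fun t : ℝ => g (a + t • v)) (A v) 0 := by
    have hA' : HasFDerivAt g A (a + (0 : ℝ) • v) := by simpa using hA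
    exact hA'.comp_hasDerivAt 0 hline
  have hderiv : HasDerivAt (fun t : ℝ => ⟪g (a + t • v), v⟫ - t * (μ * ‖v‖ ^ 2))
      (⟪A v, v⟫ - μ * ‖v‖ ^ 2) 0 := by
    simpa using (hcomp.inner ℝ (hasDerivAt_const (0 : ℝ) v)).fun_sub
      ((hasDerivAt_id (0 : ℝ)).mul_const (μ * ‖v‖ ^ 2))
  have hmono : Monotone (fun t : ℝ => ⟪g (a + t • v), v⟫ - t * (μ * ‖v‖ ^ 2)) := by
    intro s t hst
    rcases hst.eq_or_lt with rfl | hlt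
    · exact le_rfl
    have h := hg (a + t • v) (a + s • v)
    have hsub : a + t • v - (a + s • v) = (t - s) • v := by rw [sub_smul]; abel
    rw [hsub, norm_smul, inner_smul_right, inner_sub_left, mul_pow, Real.norm_eq_abs,
      sq_abs] at h
    have hpos : 0 < t - s := sub_pos.2 hlt
    have h' : (t - s) * ((t - s) * (μ * ‖v‖ ^ 2)) ≤
        (t - s) * (⟪g (a + t • v), v⟫ - ⟪g (a + s • v), v⟫) := by linarith
    have := le_of_mul_le_mul_left h' hpos
    dsimp only
    linarith
  have := hmono.deriv_nonneg (x := 0)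
  rw [hderiv.deriv] at this
  linarith

/-- A quadratically coercive operator is bounded below. -/
theorem mul_norm_le_norm_of_coercive {A : E →L[ℝ] E} {μ : ℝ}
    (hA : ∀ v, μ * ‖v‖ ^ 2 ≤ ⟪A v, v⟫) (v : E) : μ * ‖v‖ ≤ ‖A v‖ := by
  rcases (norm_nonneg v).eq_or_lt with h | h
  · simp [← h]
  · refine le_of_mul_le_mul_right ?_ h
    calc μ * ‖v‖ * ‖v‖ = μ * ‖v‖ ^ 2 := by ring
      _ ≤ ‖A v‖ * ‖v‖ := (hA v).trans (real_inner_le_norm _ _)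

/-- First-order Taylor remainder for a map with Lipschitz derivative. -/
theorem norm_sub_sub_fderiv_le {g : E → E} {H : E → E →L[ℝ] E} {M : ℝ}
    (hH : ∀ x, HasFDerivAt g (H x) x) (hLip : ∀ x y, ‖H x - H y‖ ≤ M * ‖x - y‖) (a e : E) :
    ‖g (a + e) - g a - H a e‖ ≤ M / 2 * ‖e‖ ^ 2 := by
  have hderiv : ∀ t : ℝ, HasDerivAt (fun t : ℝ => g (a + t • e) - g a - t • H a e)
      (H (a + t • e) e - H a e) t := by
    intro t
    have hline : HasDerivAt (fun t : ℝ => a + t • e) e t := by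
      simpa using ((hasDerivAt_id t).smul_const e).const_add a
    simpa using (((hH (a + t • e)).comp_hasDerivAt t hline).sub_const (g a)).fun_sub
      ((hasDerivAt_id t).smul_const (H a e))
  have hbound : ∀ t : ℝ, HasDerivAt (fun t : ℝ => M / 2 * ‖e‖ ^ 2 * t ^ 2)
      (M * ‖e‖ ^ 2 * t) t := by
    intro t
    refine ((hasDerivAt_pow 2 t).const_mul (M / 2 * ‖e‖ ^ 2)).congr_deriv ?_
    push_cast
    ring
  have h := image_norm_le_of_norm_deriv_right_le_deriv_boundary (a := (0 : ℝ)) (b := 1)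
    (fun t _ => (hderiv t).continuousAt.continuousWithinAt)
    (fun t _ => (hderiv t).hasDerivWithinAt) (by simp) hbound
    (fun t ht => by
      rw [← sub_apply]
      calc ‖(H (a + t • e) - H a) e‖ ≤ ‖H (a + t • e) - H a‖ * ‖e‖ :=
            ContinuousLinearMap.le_opNorm _ _
        _ ≤ M * ‖a + t • e - a‖ * ‖e‖ := by gcongr; exact hLip _ _
        _ = M * ‖e‖ ^ 2 * t := by
            rw [add_sub_cancel_left, norm_smul, Real.norm_of_nonneg ht.1]
            ring)
    (Set.right_mem_Icc.2 zero_le_one)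
  simpa using h

/-- In finite dimension, an operator that is bounded below is a right inverse of its
`ContinuousLinearMap.inverse`. -/
theorem apply_inverse_of_mul_norm_le [FiniteDimensional ℝ E] {A : E →L[ℝ] E} {μ : ℝ}
    (hμ : 0 < μ) (hA : ∀ v, μ * ‖v‖ ≤ ‖A v‖) (w : E) : A (A.inverse w) = w := by
  have hinj : Function.Injective (A : E →ₗ[ℝ] E) := by
    rw [injective_iff_map_eq_zero]
    intro v hv
    have h := hA v
    rw [show A v = 0 from hv, norm_zero] at h
    exact norm_le_zero_iff.1 (nonpos_of_mul_nonpos_right h hμ)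
  let L : E ≃L[ℝ] E := (LinearEquiv.ofInjectiveEndo (A : E →ₗ[ℝ] E) hinj).toContinuousLinearEquiv
  have hL : A = (L : E →L[ℝ] E) := by
    ext v
    rfl
  rw [hL, ContinuousLinearMap.inverse_equiv]
  exact L.apply_symm_apply w

end

/-- If `δ := ‖a − a⋆‖ < 2μ/M`, then the errorless Newton
update difference satisfies `‖(H_F(a))⁻¹ g_F(a)‖ ≤ 2δ`. -/
theorem stmt18 (d : ℕ) (hd : 1 ≤ d)
    (F : EuclideanSpace ℝ (Fin d) → ℝ) (hF : ContDiff ℝ 2 F)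
    (μ M : ℝ) (hμ : 0 < μ) (hM : 0 < M)
    (hconv : ∀ a b : EuclideanSpace ℝ (Fin d),
      F a ≥ F b + ⟪gradient F b, a - b⟫ + μ / 2 * ‖a - b‖ ^ 2)
    (H : EuclideanSpace ℝ (Fin d) →
      (EuclideanSpace ℝ (Fin d) →L[ℝ] EuclideanSpace ℝ (Fin d)))
    (hH : ∀ x, HasFDerivAt (gradient F) (H x) x)
    (hLip : ∀ a b : EuclideanSpace ℝ (Fin d), ‖H a - H b‖ ≤ M * ‖a - b‖)
    (astar : EuclideanSpace ℝ (Fin d)) (hmin : ∀ x, F astar ≤ F x)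
    (hmin_unique : ∀ b, (∀ x, F b ≤ F x) → b = astar)
    (a : EuclideanSpace ℝ (Fin d)) (ha : ‖a - astar‖ < 2 * μ / M) :
    ‖(H a).inverse (gradient F a)‖ ≤ 2 * ‖a - astar‖ := by
  have hmono : ∀ x y, μ * ‖x - y‖ ^ 2 ≤ ⟪gradient F x - gradient F y, x - y⟫ := by
    intro x y
    have hxy := hconv x y
    have hyx := hconv y x
    rw [← neg_sub x y, norm_neg, inner_neg_right] at hyx
    rw [inner_sub_left]
    linarith
  have hbelow := mul_norm_le_norm_of_coercive
    (mul_norm_sq_le_inner_of_hasFDerivAt hmono (hH a))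
  have hgrad : gradient F astar = 0 := by
    have hloc : IsLocalMin F astar := Filter.Eventually.of_forall hmin
    simp [gradient, hloc.fderiv_eq_zero]
  have htaylor := norm_sub_sub_fderiv_le hH hLip a (astar - a)
  rw [add_sub_cancel, hgrad, norm_sub_rev astar a] at htaylor
  have hinv := apply_inverse_of_mul_norm_le hμ hbelow (gradient F a)
  set w := (H a).inverse (gradient F a)
  have hdiff : μ * ‖w - (a - astar)‖ ≤ M / 2 * ‖a - astar‖ ^ 2 := by
    refine (hbelow _).trans (le_of_eq_of_le ?_ htaylor)
    rw [← norm_neg]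
    congr 1
    simp only [map_sub, hinv]
    abel
  have hδ : ‖a - astar‖ * M ≤ 2 * μ := ((lt_div_iff₀ hM).1 ha).le
  have hnewton : ‖w - (a - astar)‖ ≤ ‖a - astar‖ := by
    refine le_of_mul_le_mul_left (hdiff.trans ?_) hμ
    nlinarith [mul_le_mul_of_nonneg_right hδ (norm_nonneg (a - astar))]
  have := norm_le_norm_sub_add w (a - astar)
  linarith
end
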